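/- In the BIBPA setting, suppose in addition that for all k ≥ 1 and i: |α_i^k| < σ_i/2 and 0 < γ_i ≤ γ_i^k ≤ (σ_i − 2|α_i^k|)/(σ_i L_i) for constants γ_i > 0, and let δ_i ≥ 0 satisfy |α_i^k|/(σ_i γ_i^k) ≤ δ_i ≤ (1 − γ_i^k L_i)/γ_i^k − |α_i^k|/(σ_i γ_i^k) for all k. Define the Lyapunov values 𝓛^k := Φ(x^k) + Σ_{i=1}^N δ_i·D_{h_i}(x^{k−1,i}, x^{k−1,i−1}), and set a_i^k := (1 − γ_i^k L_i)/γ_i^k − |α_i^k|/(σ_i γ_i^k) − δ_i ≥ 0 and b_i^k := δ_i − |α_i^k|/(σ_i γ_i^k) ≥ 0. Then for every k ≥ 1: 𝓛^{k+1} − 𝓛^k ≤ − Σ_{i=1}^N [ a_i^k·D_{h_i}(x^{k,i}, x^{k,i−1}) + b_i^k·D_{h_i}(x^{k−1,i}, x^{k−1,i−1}) ]; in particular the sequence (𝓛^k)_{k≥1} is non-increasing. If moreover Φ is bounded below on E and there exists ρ > 0 with a_i^k ≥ ρ for all k and i, then D_{h_i}(x^{k,i}, x^{k,i−1}) → 0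 and ‖x_i^{k+1} − x_i^k‖ → 0 as k → ∞, for every i. -/

import Mathlib

open scoped RealInnerProductSpace
open Filter

/-- The `i`-th partial (block) gradient of `h` at `x`. -/
noncomputable def blockGrad {N : ℕ} {n : Fin N → ℕ}
    (h : ((j : Fin N) → EuclideanSpace ℝ (Fin (n j))) → ℝ)
    (i : Fin N) (x : (j : Fin N) → EuclideanSpace ℝ (Fin (n j))) :
    EuclideanSpace ℝ (Fin (n i)) :=
  gradient (fun z => h (Function.update x i z)) (x i)

/-- The `i`-th block Bregman distance `D_h(x⟨i←w⟩, x)`. -/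
noncomputable def blockBreg {N : ℕ} {n : Fin N → ℕ}
    (h : ((j : Fin N) → EuclideanSpace ℝ (Fin (n j))) → ℝ)
    (i : Fin N) (x : (j : Fin N) → EuclideanSpace ℝ (Fin (n j)))
    (w : EuclideanSpace ℝ (Fin (n i))) : ℝ :=
  h (Function.update x i w) - h x - ⟪blockGrad h i x, w - x i⟫

/-- The `i`-th block Bregman distance `D_h(y, y')` between two points differing
only in their `i`-th block. -/
noncomputable def bregTwo {N : ℕ} {n : Fin N → ℕ}
    (h : ((j : Fin N) → EuclideanSpace ℝ (Fin (n j))) → ℝ)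
    (i : Fin N) (y y' : (j : Fin N) → EuclideanSpace ℝ (Fin (n j))) : ℝ :=
  h y - h y' - ⟪blockGrad h i y', y i - y' i⟫

/-- The intermediate BIBPA point `x^{k,m}` whose first `m` blocks come from `x^{k+1}`
and whose remaining blocks come from `x^k`. -/
def interPt {N : ℕ} {n : Fin N → ℕ}
    (x : ℕ → (j : Fin N) → EuclideanSpace ℝ (Fin (n j))) (k m : ℕ) :
    (j : Fin N) → EuclideanSpace ℝ (Fin (n j)) :=
  fun j => if (j : ℕ) < m then x (k + 1) j else x k j

/-- The BIBPA objective `Φ(x) = f(x) + Σᵢ gᵢ(xᵢ)` with extended-real valued `gᵢ`. -/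
noncomputable def Phi {N : ℕ} {n : Fin N → ℕ}
    (f : ((j : Fin N) → EuclideanSpace ℝ (Fin (n j))) → ℝ)
    (g : (i : Fin N) → EuclideanSpace ℝ (Fin (n i)) → EReal)
    (y : (j : Fin N) → EuclideanSpace ℝ (Fin (n j))) : EReal :=
  ((f y : ℝ) : EReal) + ∑ i, g i (y i)

/-- First-order characterization of convexity: a convex function lies above its tangents. -/
theorem ConvexOn.add_hasFDerivAt_le {F : Type*} [NormedAddCommGroup F] [NormedSpace ℝ F]
    {φ : F → ℝ} (hφ : ConvexOn ℝ Set.univ φ) {φ' : F →L[ℝ] ℝ} {a : F}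
    (hd : HasFDerivAt φ φ' a) (w : F) : φ a + φ' (w - a) ≤ φ w := by
  have hline : HasDerivAt (fun t : ℝ => AffineMap.lineMap a w t) (w - a) 0 :=
    AffineMap.hasDerivAt_lineMap
  have hcomp : HasDerivAt (φ ∘ fun t : ℝ => AffineMap.lineMap a w t) (φ' (w - a)) 0 := by
    refine HasFDerivAt.comp_hasDerivAt (0 : ℝ) ?_ hline
    simpa using hd
  have hconv : ConvexOn ℝ Set.univ (φ ∘ fun t : ℝ => AffineMap.lineMap a w t) := by
    simpa using hφ.comp_affineMap (AffineMap.lineMap a w)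
  have hslope := hconv.le_slope_of_hasDerivAt (Set.mem_univ 0) (Set.mem_univ 1) one_pos hcomp
  simp only [slope_def_field, Function.comp_apply, AffineMap.lineMap_apply_one,
    AffineMap.lineMap_apply_zero, sub_zero, div_one] at hslope
  linarith

section Block

variable {N : ℕ} {n : Fin N → ℕ}

theorem Differentiable.comp_update {h : ((j : Fin N) → EuclideanSpace ℝ (Fin (n j))) → ℝ}
    (hd : Differentiable ℝ h) (i : Fin N) (x : (j : Fin N) → EuclideanSpace ℝ (Fin (n j))) :
    Differentiable ℝ (fun z : EuclideanSpace ℝ (Fin (n i)) => h (Function.update x i z)) :=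
  fun z => (hd _).comp z (hasFDerivAt_update x z).differentiableAt

theorem inner_blockGrad (h : ((j : Fin N) → EuclideanSpace ℝ (Fin (n j))) → ℝ)
    (i : Fin N) (x : (j : Fin N) → EuclideanSpace ℝ (Fin (n j)))
    (v : EuclideanSpace ℝ (Fin (n i))) :
    ⟪blockGrad h i x, v⟫ = fderiv ℝ (fun z => h (Function.update x i z)) (x i) v := by
  rw [blockGrad, inner_gradient_left]

/-- Strong convexity along a block bounds the block Bregman distance from below. -/
theorem half_mul_norm_sq_le_blockBreg
    {h : ((j : Fin N) → EuclideanSpace ℝ (Fin (n j))) → ℝ} (hd : Differentiable ℝ h)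
    {i : Fin N} {x : (j : Fin N) → EuclideanSpace ℝ (Fin (n j))} {s : ℝ}
    (hs : ConvexOn ℝ Set.univ (fun z : EuclideanSpace ℝ (Fin (n i)) =>
      h (Function.update x i z) - s / 2 * ‖z‖ ^ 2))
    (w : EuclideanSpace ℝ (Fin (n i))) :
    s / 2 * ‖w - x i‖ ^ 2 ≤ blockBreg h i x w := by
  have hder := ((hd.comp_update i x) (x i)).hasFDerivAt.sub
    (((hasStrictFDerivAt_norm_sq (x i)).hasFDerivAt).const_mul (s / 2))
  have key := hs.add_hasFDerivAt_le hder w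
  have hnorm : ‖w‖ ^ 2 = ‖x i‖ ^ 2 + 2 * ⟪x i, w - x i⟫ + ‖w - x i‖ ^ 2 := by
    rw [← norm_add_sq_real, add_sub_cancel]
  simp only [Function.update_eq_self, sub_apply,
    smul_apply, innerSL_apply_apply, smul_eq_mul, nsmul_eq_mul,
    Nat.cast_ofNat] at key
  rw [blockBreg, inner_blockGrad]
  rw [hnorm] at key
  linarith

/-- Descent lemma for relatively smooth functions, along a block. -/
theorem blockBreg_le_mul_blockBreg
    {h f : ((j : Fin N) → EuclideanSpace ℝ (Fin (n j))) → ℝ}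
    (hd : Differentiable ℝ h) (hf : Differentiable ℝ f)
    {i : Fin N} {x : (j : Fin N) → EuclideanSpace ℝ (Fin (n j))} {l : ℝ}
    (hl : ConvexOn ℝ Set.univ (fun z : EuclideanSpace ℝ (Fin (n i)) =>
      l * h (Function.update x i z) - f (Function.update x i z)))
    (w : EuclideanSpace ℝ (Fin (n i))) :
    blockBreg f i x w ≤ l * blockBreg h i x w := by
  have hder := (((hd.comp_update i x) (x i)).hasFDerivAt.const_mul l).sub
    ((hf.comp_update i x) (x i)).hasFDerivAt
  have key := hl.add_hasFDerivAt_le hder w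
  simp only [Function.update_eq_self, sub_apply,
    smul_apply, smul_eq_mul] at key
  rw [blockBreg, blockBreg, inner_blockGrad, inner_blockGrad]
  linarith

@[simp]
theorem blockBreg_self (h : ((j : Fin N) → EuclideanSpace ℝ (Fin (n j))) → ℝ)
    (i : Fin N) (x : (j : Fin N) → EuclideanSpace ℝ (Fin (n j))) :
    blockBreg h i x (x i) = 0 := by
  simp [blockBreg]

variable (x : ℕ → (j : Fin N) → EuclideanSpace ℝ (Fin (n j))) (k : ℕ)

theorem interPt_apply_self (i : Fin N) : interPt x k i i = x k i := by
  simp [interPt]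

theorem interPt_succ (i : Fin N) :
    interPt x k (i + 1) = Function.update (interPt x k i) i (x (k + 1) i) := by
  funext j
  rcases eq_or_ne j i with rfl | hj
  · simp [interPt]
  · have : (j : ℕ) ≠ i := fun e => hj (Fin.ext e)
    rw [Function.update_of_ne hj]
    simp only [interPt, Nat.lt_succ_iff_lt_or_eq, this, or_false]

theorem bregTwo_interPt (h : ((j : Fin N) → EuclideanSpace ℝ (Fin (n j))) → ℝ) (i : Fin N) :
    bregTwo h i (interPt x k (i + 1)) (interPt x k i)
      = blockBreg h i (interPt x k i) (x (k + 1) i) := by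
  simp [bregTwo, blockBreg, interPt_succ]

theorem sum_interPt_succ_sub (f : ((j : Fin N) → EuclideanSpace ℝ (Fin (n j))) → ℝ) :
    ∑ i : Fin N, (f (interPt x k (i + 1)) - f (interPt x k i)) = f (x (k + 1)) - f (x k) := by
  rw [Fin.sum_univ_eq_sum_range (fun m => f (interPt x k (m + 1)) - f (interPt x k m)),
    Finset.sum_range_sub (fun m => f (interPt x k m))]
  congr 2
  funext j
  simp [interPt]

end Block

theorem EReal.coe_finset_sum {ι : Type*} (s : Finset ι) (u : ι → ℝ) :
    ((∑ i ∈ s, u i : ℝ) : EReal) = ∑ i ∈ s, (u i : EReal) := by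
  classical
  induction s using Finset.induction_on with
  | empty => simp
  | insert a s ha ih => simp [Finset.sum_insert ha, ih]

/-- Young's inequality for the inertial term, with the squared norms absorbed by Bregman
distances. -/
theorem div_mul_inner_le {F : Type*} [NormedAddCommGroup F] [InnerProductSpace ℝ F]
    {u v : F} {a c s D D' : ℝ} (hc : 0 < c) (hs : 0 < s)
    (hu : s / 2 * ‖u‖ ^ 2 ≤ D) (hv : s / 2 * ‖v‖ ^ 2 ≤ D') :
    a / c * ⟪u, v⟫ ≤ |a| / (s * c) * (D + D') := by
  have hinner : a * ⟪u, v⟫ ≤ |a| * (‖u‖ * ‖v‖) :=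
    (le_abs_self _).trans <| by
      rw [abs_mul]
      gcongr
      exact abs_real_inner_le_norm u v
  have hyoung : s * (‖u‖ * ‖v‖) ≤ D + D' := by
    nlinarith [mul_nonneg hs.le (sq_nonneg (‖u‖ - ‖v‖))]
  calc a / c * ⟪u, v⟫ = a * ⟪u, v⟫ / c := by ring
    _ ≤ |a| * (‖u‖ * ‖v‖) / c := by gcongr
    _ = |a| / (s * c) * (s * (‖u‖ * ‖v‖)) := by field_simp
    _ ≤ |a| / (s * c) * (D + D') := by gcongr

/-- Descent property of the BIBPA Lyapunov function. -/
theorem bibpa_lyapunov_descent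
    {N : ℕ} {n : Fin N → ℕ}
    (h : (i : Fin N) → ((j : Fin N) → EuclideanSpace ℝ (Fin (n j))) → ℝ)
    (σ L : Fin N → ℝ) (hσ : ∀ i, 0 < σ i) (hL : ∀ i, 0 < L i)
    (hhdiff : ∀ i, Differentiable ℝ (h i))
    (hstrong : ∀ i x, ConvexOn ℝ Set.univ
      (fun z : EuclideanSpace ℝ (Fin (n i)) =>
        h i (Function.update x i z) - σ i / 2 * ‖z‖ ^ 2))
    (f : ((j : Fin N) → EuclideanSpace ℝ (Fin (n j))) → ℝ)
    (hfdiff : Differentiable ℝ f)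
    (hrel : ∀ i x, ConvexOn ℝ Set.univ
      (fun z : EuclideanSpace ℝ (Fin (n i)) =>
        L i * h i (Function.update x i z) - f (Function.update x i z)))
    (g : (i : Fin N) → EuclideanSpace ℝ (Fin (n i)) → EReal)
    (hgproper : ∀ i, ∃ z, g i z ≠ ⊤) (hgreal : ∀ i z, g i z ≠ ⊥)
    (hglsc : ∀ i, LowerSemicontinuous (g i))
    (x : ℕ → (j : Fin N) → EuclideanSpace ℝ (Fin (n j)))
    (γ α : Fin N → ℕ → ℝ) (hγpos : ∀ i k, 0 < γ i k)
    (hfin : ∀ k i, g i (x k i) ≠ ⊤)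
    (hmin : ∀ k, 1 ≤ k → ∀ (i : Fin N) (z : EuclideanSpace ℝ (Fin (n i))),
      g i (x (k + 1) i)
        + ((⟪blockGrad f i (interPt x k i)
              - (α i k / γ i k) • (x k i - x (k - 1) i), x (k + 1) i - x k i⟫
            + 1 / γ i k * blockBreg (h i) i (interPt x k i) (x (k + 1) i) : ℝ) : EReal)
      ≤ g i z
        + ((⟪blockGrad f i (interPt x k i)
              - (α i k / γ i k) • (x k i - x (k - 1) i), z - x k i⟫
            + 1 / γ i k * blockBreg (h i) i (interPt x k i) z : ℝ) : EReal))
    (γlb : Fin N → ℝ) (hγlb : ∀ i, 0 < γlb i)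
    (hα : ∀ k, 1 ≤ k → ∀ i, |α i k| < σ i / 2)
    (hγbounds : ∀ k, 1 ≤ k → ∀ i,
      γlb i ≤ γ i k ∧ γ i k ≤ (σ i - 2 * |α i k|) / (σ i * L i))
    (δ : Fin N → ℝ) (hδ0 : ∀ i, 0 ≤ δ i)
    (hδ : ∀ k, 1 ≤ k → ∀ i,
      |α i k| / (σ i * γ i k) ≤ δ i
        ∧ δ i ≤ (1 - γ i k * L i) / γ i k - |α i k| / (σ i * γ i k)) :
    -- Lyapunov values 𝓛^k := Φ(x^k) + Σᵢ δᵢ·D_{hᵢ}(x^{k−1,i}, x^{k−1,i−1})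
    (∀ k, 1 ≤ k →
      (Phi f g (x (k + 1))
          + ((∑ i : Fin N, δ i
                * bregTwo (h i) i (interPt x k (i + 1)) (interPt x k i) : ℝ) : EReal))
        - (Phi f g (x k)
          + ((∑ i : Fin N, δ i
                * bregTwo (h i) i (interPt x (k - 1) (i + 1)) (interPt x (k - 1) i)
              : ℝ) : EReal))
      ≤ -((∑ i : Fin N,
            (((1 - γ i k * L i) / γ i k - |α i k| / (σ i * γ i k) - δ i)
                * bregTwo (h i) i (interPt x k (i + 1)) (interPt x k i)
              + (δ i - |α i k| / (σ i * γ i k))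
                * bregTwo (h i) i (interPt x (k - 1) (i + 1)) (interPt x (k - 1) i))
          : ℝ) : EReal)) ∧
    (∀ k, 1 ≤ k →
      (Phi f g (x (k + 1))
          + ((∑ i : Fin N, δ i
                * bregTwo (h i) i (interPt x k (i + 1)) (interPt x k i) : ℝ) : EReal))
        ≤ (Phi f g (x k)
          + ((∑ i : Fin N, δ i
                * bregTwo (h i) i (interPt x (k - 1) (i + 1)) (interPt x (k - 1) i)
              : ℝ) : EReal))) ∧
    ((∃ M : ℝ, ∀ y, (M : EReal) ≤ Phi f g y) →
      ∀ ρ : ℝ, 0 < ρ →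
      (∀ k, 1 ≤ k → ∀ i,
        ρ ≤ (1 - γ i k * L i) / γ i k - |α i k| / (σ i * γ i k) - δ i) →
      ∀ i : Fin N,
        Tendsto (fun k => bregTwo (h i) i (interPt x k (i + 1)) (interPt x k i))
            atTop (nhds 0) ∧
        Tendsto (fun k => ‖x (k + 1) i - x k i‖) atTop (nhds 0)) := by
  set D : ℕ → Fin N → ℝ :=
    fun k i => bregTwo (h i) i (interPt x k (i + 1)) (interPt x k i) with hD
  have hDlb : ∀ k i, σ i / 2 * ‖x (k + 1) i - x k i‖ ^ 2 ≤ D k i := by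
    intro k i
    have := half_mul_norm_sq_le_blockBreg (hhdiff i) (hstrong i (interPt x k i)) (x (k + 1) i)
    rwa [← bregTwo_interPt, interPt_apply_self] at this
  have hD0 : ∀ k i, 0 ≤ D k i := fun k i =>
    (mul_nonneg (half_pos (hσ i)).le (sq_nonneg _)).trans (hDlb k i)
  choose G hG using fun k i => (⟨(g i (x k i)).toReal,
    (EReal.coe_toReal (hfin k i) (hgreal i _)).symm⟩ : ∃ r : ℝ, g i (x k i) = r)
  have hPhi : ∀ k, Phi f g (x k) = ((f (x k) + ∑ i, G k i : ℝ) : EReal) := by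
    intro k
    simp only [Phi, hG, EReal.coe_add, EReal.coe_finset_sum]
  have hblock : ∀ k, 1 ≤ k → ∀ i : Fin N,
      f (interPt x k (i + 1)) - f (interPt x k i) + (G (k + 1) i - G k i)
        + (1 / γ i k - L i) * D k i ≤ |α i k| / (σ i * γ i k) * (D (k - 1) i + D k i) := by
    intro k hk i
    have hprox := hmin k hk i (x k i)
    have hsmooth := blockBreg_le_mul_blockBreg (hhdiff i) hfdiff
      (hrel i (interPt x k i)) (x (k + 1) i)
    have hself : blockBreg (h i) i (interPt x k i) (x k i) = 0 := by
      conv_lhs => rw [← interPt_apply_self x k i]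
      exact blockBreg_self _ _ _
    have hprev := hDlb (k - 1) i
    rw [Nat.sub_add_cancel hk] at hprev
    have hyoung := div_mul_inner_le (a := α i k) (hγpos i k) (hσ i) hprev (hDlb k i)
    rw [hself, hG, hG, ← bregTwo_interPt, sub_self, inner_zero_right, inner_sub_left,
      real_inner_smul_left] at hprox
    norm_cast at hprox
    rw [← bregTwo_interPt, ← bregTwo_interPt, bregTwo, interPt_succ, Function.update_self,
      interPt_apply_self, ← interPt_succ] at hsmooth
    simp only [hD] at hyoung ⊢
    linarith
  have hdescent : ∀ k, 1 ≤ k →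
      (f (x (k + 1)) + ∑ i, G (k + 1) i + ∑ i, δ i * D k i)
        - (f (x k) + ∑ i, G k i + ∑ i, δ i * D (k - 1) i)
      ≤ -∑ i, (((1 - γ i k * L i) / γ i k - |α i k| / (σ i * γ i k) - δ i) * D k i
          + (δ i - |α i k| / (σ i * γ i k)) * D (k - 1) i) := by
    intro k hk
    have hsum := Finset.sum_le_sum fun i (_ : i ∈ Finset.univ) => hblock k hk i
    have hcoef : ∀ i, (1 - γ i k * L i) / γ i k = 1 / γ i k - L i := fun i => by
      have := (hγpos i k).ne'
      field_simp
    simp only [hcoef]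
    rw [Finset.sum_add_distrib, Finset.sum_add_distrib, sum_interPt_succ_sub,
      Finset.sum_sub_distrib] at hsum
    have hsplit : ∑ i, ((1 / γ i k - L i - |α i k| / (σ i * γ i k) - δ i) * D k i
          + (δ i - |α i k| / (σ i * γ i k)) * D (k - 1) i)
        = ∑ i, (1 / γ i k - L i) * D k i
          - ∑ i, |α i k| / (σ i * γ i k) * (D (k - 1) i + D k i)
          - ∑ i, δ i * D k i + ∑ i, δ i * D (k - 1) i := by
      rw [← Finset.sum_sub_distrib, ← Finset.sum_sub_distrib, ← Finset.sum_add_distrib]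
      exact Finset.sum_congr rfl fun i _ => by ring
    linarith
  have hb : ∀ k, 1 ≤ k → ∀ i, 0 ≤ (δ i - |α i k| / (σ i * γ i k)) * D (k - 1) i :=
    fun k hk i => mul_nonneg (sub_nonneg.2 (hδ k hk i).1) (hD0 _ _)
  have hmono : ∀ k, 1 ≤ k →
      f (x (k + 1)) + ∑ i, G (k + 1) i + ∑ i, δ i * D k i
        ≤ f (x k) + ∑ i, G k i + ∑ i, δ i * D (k - 1) i := by
    intro k hk
    have := hdescent k hk
    have hnonneg : 0 ≤ ∑ i, (((1 - γ i k * L i) / γ i k - |α i k| / (σ i * γ i k) - δ i) * D k i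
        + (δ i - |α i k| / (σ i * γ i k)) * D (k - 1) i) :=
      Finset.sum_nonneg fun i _ =>
        add_nonneg (mul_nonneg (sub_nonneg.2 (hδ k hk i).2) (hD0 _ _)) (hb k hk i)
    linarith
  refine ⟨fun k hk => ?_, fun k hk => ?_, ?_⟩
  · rw [hPhi, hPhi]
    exact_mod_cast hdescent k hk
  · rw [hPhi, hPhi]
    exact_mod_cast hmono k hk
  · rintro ⟨M, hM⟩ ρ hρ hρa i
    set V : ℕ → ℝ :=
      fun k => f (x (k + 1)) + ∑ i, G (k + 1) i + ∑ i, δ i * D k i with hV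
    have hanti : Antitone V := antitone_nat_of_succ_le fun k => hmono (k + 1) k.succ_pos
    have hbdd : BddBelow (Set.range V) := by
      refine ⟨M, ?_⟩
      rintro _ ⟨k, rfl⟩
      have hMk := hM (x (k + 1))
      rw [hPhi, EReal.coe_le_coe_iff] at hMk
      exact le_add_of_le_of_nonneg hMk
        (Finset.sum_nonneg fun i _ => mul_nonneg (hδ0 i) (hD0 k i))
    have hlim := tendsto_atTop_ciInf hanti hbdd
    have hdiff : Tendsto (fun k => (V k - V (k + 1)) / ρ) atTop (nhds 0) := by
      simpa using (hlim.sub (hlim.comp (tendsto_add_atTop_nat 1))).div_const ρ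
    have hDle : ∀ k, D (k + 1) i ≤ (V k - V (k + 1)) / ρ := by
      intro k
      have hk := k.succ_pos
      have hle : ρ * D (k + 1) i ≤ ∑ i, (((1 - γ i (k + 1) * L i) / γ i (k + 1)
            - |α i (k + 1)| / (σ i * γ i (k + 1)) - δ i) * D (k + 1) i
          + (δ i - |α i (k + 1)| / (σ i * γ i (k + 1))) * D k i) := by
        refine le_trans ?_ (Finset.single_le_sum (fun j _ => add_nonneg
          (mul_nonneg (hρ.le.trans (hρa _ hk j)) (hD0 _ _)) (hb _ hk j)) (Finset.mem_univ i))
        exact le_add_of_le_of_nonneg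
          (mul_le_mul_of_nonneg_right (hρa _ hk i) (hD0 _ _)) (hb _ hk i)
      rw [le_div_iff₀ hρ]
      have := hdescent (k + 1) hk
      simp only [Nat.add_sub_cancel] at this
      simp only [hV]
      linarith
    have hDlim : Tendsto (fun k => D k i) atTop (nhds 0) :=
      (tendsto_add_atTop_iff_nat 1).1 (squeeze_zero (fun k => hD0 _ _) hDle hdiff)
    refine ⟨hDlim, ?_⟩
    have hsqrt : Tendsto (fun k => √(2 / σ i * D k i)) atTop (nhds 0) := by
      simpa using (hDlim.const_mul (2 / σ i)).sqrt
    refine squeeze_zero (fun _ => norm_nonneg _) (fun k => Real.le_sqrt_of_sq_le ?_) hsqrt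
    have hσi := hσ i
    calc ‖x (k + 1) i - x k i‖ ^ 2
        = 2 / σ i * (σ i / 2 * ‖x (k + 1) i - x k i‖ ^ 2) := by field_simp
      _ ≤ 2 / σ i * D k i := by
        gcongr
        exact hDlb k i
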